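/- Let e : Ω × [t₀,∞) → ℝ be a classical (C²) solution of the forward error system with damping gain k > 0 and continuous coefficient g. Then for all t > t₀: d/dt ∫_Ω [2(xᵀ∇e) + (n−1)e] e_t dx = −∫_Ω (e_t² + |∇e|²) dx + ∫_Ω [2(xᵀ∇e) + (n−1)e] g e dx − ∫_{Γ_N} [ |∇e|² + 2k (xᵀ∇e) e_t ] dΓ + ∫_{Γ_N} [ e_t² − k(n−1) e e_t ] dΓ. -/

import Mathlib

open MeasureTheory Real Matrix

noncomputable section

/-- The closed unit hypercube `[0,1]^n`. -/
def cube (n : ℕ) : Set (Fin n → ℝ) := Set.univ.pi fun _ => Set.Icc (0:ℝ) 1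

/-- Partial derivative of `u` in the `p`-th coordinate direction. -/
def pd {n : ℕ} (p : Fin n) (u : (Fin n → ℝ) → ℝ) (x : Fin n → ℝ) : ℝ :=
  fderiv ℝ u x (Pi.single p 1)

/-- Squared Euclidean norm of the gradient, `|∇u|²`. -/
def gradSq {n : ℕ} (u : (Fin n → ℝ) → ℝ) (x : Fin n → ℝ) : ℝ := ∑ p, (pd p u x) ^ 2

/-- Laplacian `Δu = Σ_p u_{x_p x_p}`. -/
def lap {n : ℕ} (u : (Fin n → ℝ) → ℝ) (x : Fin n → ℝ) : ℝ := ∑ p, pd p (pd p u) x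

/-- Surface integral over `Γ_N`: `Σ_p ∫_{[0,1]^{n-1}} h|_{x_p = 1} dx'`
(each face integral realized as an integral over the cube of a function
independent of the `p`-th coordinate). -/
def faceInt {n : ℕ} (h : (Fin n → ℝ) → ℝ) : ℝ :=
  ∑ p : Fin n, ∫ x in cube n, h (Function.update x p 1)

/-- `xᵀ∇u`. -/
def xGrad {n : ℕ} (u : (Fin n → ℝ) → ℝ) (x : Fin n → ℝ) : ℝ := ∑ p, x p * pd p u x

/-- Minimal eigenvalue of a symmetric matrix, via the Rayleigh quotient. -/
def lamMin (M : Matrix (Fin 3) (Fin 3) ℝ) : ℝ :=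
  sInf {r | ∃ v : Fin 3 → ℝ, (∑ i, (v i) ^ 2) = 1 ∧ r = v ⬝ᵥ M.mulVec v}

/-- Maximal eigenvalue of a symmetric matrix, via the Rayleigh quotient. -/
def lamMax (M : Matrix (Fin 3) (Fin 3) ℝ) : ℝ :=
  sSup {r | ∃ v : Fin 3 → ℝ, (∑ i, (v i) ^ 2) = 1 ∧ r = v ⬝ᵥ M.mulVec v}

/-- Negative definiteness. -/
def NegDefM {m : ℕ} (M : Matrix (Fin m) (Fin m) ℝ) : Prop := (-M).PosDef

/-- Negative semidefiniteness. -/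
def NegSemidefM {m : ℕ} (M : Matrix (Fin m) (Fin m) ℝ) : Prop := (-M).PosSemidef

/-- The matrix `Φ₀` of LMI (12). -/
def Phi0 (n : ℕ) (χ lam0 : ℝ) : Matrix (Fin 3) (Fin 3) ℝ :=
  !![1/2 - 4*lam0/(π^2*n), Real.sqrt n * χ, 0;
     Real.sqrt n * χ, 1/2, ((n:ℝ)-1)*χ/2;
     0, ((n:ℝ)-1)*χ/2, lam0]

/-- `Φ₁ = Φ₀ + diag(4λ₀/(π²n), 0, 0)`. -/
def Phi1 (n : ℕ) (χ lam0 : ℝ) : Matrix (Fin 3) (Fin 3) ℝ :=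
  Phi0 n χ lam0 + Matrix.diagonal ![4*lam0/(π^2*n), 0, 0]

/-- The matrix `Ψ₂` of LMI (14). -/
def Psi2 (n : ℕ) (k χ δ g1 lam1 : ℝ) : Matrix (Fin 3) (Fin 3) ℝ :=
  !![-χ + δ*(1 + χ*k*((n:ℝ)-1)) + 4*lam1/(π^2*n), 2*δ*Real.sqrt n*χ, Real.sqrt n*g1*χ;
     2*δ*Real.sqrt n*χ, -χ + δ, g1/2 + δ*((n:ℝ)-1)*χ;
     Real.sqrt n*g1*χ, g1/2 + δ*((n:ℝ)-1)*χ, -lam1 + g1*((n:ℝ)-1)*χ]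

/-- The matrix `Φ` of the exact-observability LMI (32), with `σ = e^{-2δT*}`. -/
def PhiM (n : ℕ) (χ σ lam2 : ℝ) : Matrix (Fin 3) (Fin 3) ℝ :=
  !![-(1-σ)/2 + 4*lam2/(π^2*n), Real.sqrt n*(1+σ)*χ, 0;
     Real.sqrt n*(1+σ)*χ, -(1-σ)/2, ((n:ℝ)-1)*(1+σ)*χ/2;
     0, ((n:ℝ)-1)*(1+σ)*χ/2, -lam2]

/-- `α = 2λ_min(Φ₀)`. -/
def alphaC (n : ℕ) (χ lam0 : ℝ) : ℝ := 2 * lamMin (Phi0 n χ lam0)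

/-- `β = 2(1 + 4/(π²n))λ_max(Φ₁) + χk(n−1)`. -/
def betaC (n : ℕ) (k χ lam0 : ℝ) : ℝ :=
  2 * (1 + 4/(π^2*n)) * lamMax (Phi1 n χ lam0) + χ*k*((n:ℝ)-1)

theorem isCompact_cube (n : ℕ) : IsCompact (cube n) :=
  isCompact_univ_pi fun _ => isCompact_Icc

theorem measurableSet_cube (n : ℕ) : MeasurableSet (cube n) :=
  (isCompact_cube n).isClosed.measurableSet

theorem Continuous.integrableOn_cube {n : ℕ} {f : (Fin n → ℝ) → ℝ} (hf : Continuous f) :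
    IntegrableOn f (cube n) :=
  hf.continuousOn.integrableOn_compact (isCompact_cube n)

theorem update_mem_cube {n : ℕ} {x : Fin n → ℝ} (hx : x ∈ cube n) (p : Fin n) {s : ℝ}
    (hs : s ∈ Set.Icc (0:ℝ) 1) : Function.update x p s ∈ cube n := by
  intro q hq
  rcases eq_or_ne q p with rfl | h
  · simpa using hs
  · simpa [h] using hx q hq

/-- Fubini on the cube, singling out the `p`-th coordinate. -/
theorem integral_cube_succ {n : ℕ} (p : Fin (n + 1)) {f : (Fin (n + 1) → ℝ) → ℝ}
    (hf : Continuous f) :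
    ∫ x in cube (n + 1), f x =
      ∫ y in cube n, ∫ s in Set.Icc (0:ℝ) 1, f (p.insertNth s y) := by
  have hcont : Continuous fun z : ℝ × (Fin n → ℝ) =>
      f (p.insertNth (α := fun _ => ℝ) z.1 z.2) :=
    hf.comp (Continuous.finInsertNth (A := fun _ => ℝ) p continuous_fst continuous_snd)
  have hmp := (volume_preserving_piFinSuccAbove (fun _ : Fin (n + 1) => ℝ) p).symm
  have hpre : (MeasurableEquiv.piFinSuccAbove (fun _ : Fin (n + 1) => ℝ) p).symm ⁻¹'
      cube (n + 1) = Set.Icc (0:ℝ) 1 ×ˢ cube n := by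
    ext z
    simp only [cube, Set.mem_preimage, Set.mem_univ_pi, Set.mem_prod,
      MeasurableEquiv.piFinSuccAbove_symm_apply]
    rw [Fin.forall_iff_succAbove p]
    simp [Fin.insertNthEquiv]
  rw [← hmp.setIntegral_preimage_emb (MeasurableEquiv.measurableEmbedding _), hpre,
    Measure.volume_eq_prod, ← Measure.prod_restrict, integral_prod_symm]
  · rfl
  · rw [Measure.prod_restrict, ← Measure.volume_eq_prod]
    exact hcont.continuousOn.integrableOn_compact (isCompact_Icc.prod (isCompact_cube n))

theorem hasDerivAt_comp_update {n : ℕ} {u : (Fin n → ℝ) → ℝ} {x : Fin n → ℝ} {p : Fin n}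
    {s : ℝ} (hu : DifferentiableAt ℝ u (Function.update x p s)) :
    HasDerivAt (fun r => u (Function.update x p r)) (pd p u (Function.update x p s)) s :=
  hu.hasFDerivAt.comp_hasDerivAt s (hasDerivAt_update x p s)

theorem contDiff_pd {n : ℕ} {u : (Fin n → ℝ) → ℝ} {m : ℕ} (hu : ContDiff ℝ (m + 1) u)
    (p : Fin n) : ContDiff ℝ m (pd p u) :=
  (hu.fderiv_right le_rfl).clm_apply contDiff_const

theorem continuous_pd {n : ℕ} {u : (Fin n → ℝ) → ℝ} (hu : ContDiff ℝ 1 u) (p : Fin n) :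
    Continuous (pd p u) :=
  (hu.continuous_fderiv one_ne_zero).clm_apply continuous_const

/-- Integration of a partial derivative over the cube. -/
theorem integral_cube_pd {n : ℕ} (p : Fin n) {h : (Fin n → ℝ) → ℝ} (hh : ContDiff ℝ 1 h) :
    ∫ x in cube n, pd p h x =
      ∫ x in cube n, (h (Function.update x p 1) - h (Function.update x p 0)) := by
  cases n with
  | zero => exact p.elim0
  | succ n =>
    have hc := hh.continuous
    rw [integral_cube_succ p (continuous_pd hh p), integral_cube_succ p (by fun_prop)]
    congr 1
    ext y
    simp only [Fin.update_insertNth, integral_Icc_eq_integral_Ioc]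
    rw [← intervalIntegral.integral_of_le zero_le_one, ← intervalIntegral.integral_of_le
      zero_le_one, intervalIntegral.integral_const, sub_zero, one_smul]
    have key : ∀ s, HasDerivAt (fun r => h (p.insertNth (α := fun _ => ℝ) r y))
        (pd p h (p.insertNth s y)) s := by
      intro s
      have := hasDerivAt_comp_update (x := p.insertNth (α := fun _ => ℝ) 0 y) (p := p) (s := s)
        (hh.differentiable one_ne_zero _)
      simpa only [Fin.update_insertNth] using this
    refine intervalIntegral.integral_eq_sub_of_hasDerivAt (fun s _ => key s) ?_
    exact ((continuous_pd hh p).comp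
      (continuous_id.finInsertNth p continuous_const)).intervalIntegrable _ _

theorem pd_add {n : ℕ} {u v : (Fin n → ℝ) → ℝ} (hu : ContDiff ℝ 1 u) (hv : ContDiff ℝ 1 v)
    (p : Fin n) (x : Fin n → ℝ) : pd p (fun y => u y + v y) x = pd p u x + pd p v x := by
  simp only [pd]
  rw [fderiv_fun_add (hu.differentiable one_ne_zero x) (hv.differentiable one_ne_zero x)]
  rfl

theorem pd_sub {n : ℕ} {u v : (Fin n → ℝ) → ℝ} (hu : ContDiff ℝ 1 u) (hv : ContDiff ℝ 1 v)
    (p : Fin n) (x : Fin n → ℝ) : pd p (fun y => u y - v y) x = pd p u x - pd p v x := by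
  simp only [pd]
  rw [fderiv_fun_sub (hu.differentiable one_ne_zero x) (hv.differentiable one_ne_zero x)]
  rfl

theorem pd_mul {n : ℕ} {u v : (Fin n → ℝ) → ℝ} (hu : ContDiff ℝ 1 u) (hv : ContDiff ℝ 1 v)
    (p : Fin n) (x : Fin n → ℝ) :
    pd p (fun y => u y * v y) x = pd p u x * v x + u x * pd p v x := by
  simp only [pd]
  rw [fderiv_fun_mul (hu.differentiable one_ne_zero x) (hv.differentiable one_ne_zero x)]
  simp
  ring

theorem pd_sum {n : ℕ} {u : Fin n → (Fin n → ℝ) → ℝ} (hu : ∀ q, ContDiff ℝ 1 (u q))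
    (p : Fin n) (x : Fin n → ℝ) : pd p (fun y => ∑ q, u q y) x = ∑ q, pd p (u q) x := by
  simp only [pd]
  rw [fderiv_fun_sum fun q _ => (hu q).differentiable one_ne_zero x]
  simp

theorem pd_const {n : ℕ} (c : ℝ) (p : Fin n) (x : Fin n → ℝ) : pd p (fun _ => c) x = 0 := by
  simp [pd]

theorem pd_coord {n : ℕ} (p q : Fin n) (x : Fin n → ℝ) :
    pd p (fun y => y q) x = if q = p then 1 else 0 := by
  have : fderiv ℝ (fun y : Fin n → ℝ => y q) x = ContinuousLinearMap.proj q :=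
    (ContinuousLinearMap.proj (R := ℝ) (φ := fun _ : Fin n => ℝ) q).fderiv
  simp [pd, this, Pi.single_apply]

theorem pd_comm {n : ℕ} {u : (Fin n → ℝ) → ℝ} (hu : ContDiff ℝ 2 u) (p q : Fin n)
    (x : Fin n → ℝ) : pd p (pd q u) x = pd q (pd p u) x := by
  have hd : DifferentiableAt ℝ (fderiv ℝ u) x :=
    (hu.fderiv_right (m := 1) le_rfl).differentiable one_ne_zero x
  have h (a b : Fin n) : pd a (pd b u) x =
      fderiv ℝ (fderiv ℝ u) x (Pi.single a 1) (Pi.single b 1) := by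
    change fderiv ℝ (fun y => fderiv ℝ u y (Pi.single b 1)) x (Pi.single a 1) = _
    rw [fderiv_clm_apply hd (differentiableAt_const _)]
    simp
  rw [h, h]
  exact (hu.contDiffAt.isSymmSndFDerivAt (by simp)) _ _

/-- The vector field whose divergence is the Rellich multiplier expression. -/
def rellichField {n : ℕ} (u v : (Fin n → ℝ) → ℝ) (p : Fin n) (x : Fin n → ℝ) : ℝ :=
  x p * (v x * v x) + 2 * (xGrad u x * pd p u x) - x p * gradSq u x
    + ((n:ℝ) - 1) * (u x * pd p u x)

theorem contDiff_xGrad {n : ℕ} {u : (Fin n → ℝ) → ℝ} {m : ℕ} (hu : ContDiff ℝ (m + 1) u) :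
    ContDiff ℝ m (xGrad u) :=
  ContDiff.sum fun p _ => (contDiff_apply ℝ ℝ p).mul (contDiff_pd hu p)

theorem contDiff_gradSq {n : ℕ} {u : (Fin n → ℝ) → ℝ} {m : ℕ} (hu : ContDiff ℝ (m + 1) u) :
    ContDiff ℝ m (gradSq u) :=
  ContDiff.sum fun p _ => (contDiff_pd hu p).pow 2

theorem contDiff_rellichField {n : ℕ} {u v : (Fin n → ℝ) → ℝ} (hu : ContDiff ℝ 2 u)
    (hv : ContDiff ℝ 1 v) (p : Fin n) : ContDiff ℝ 1 (rellichField u v p) := by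
  have h1 : ContDiff ℝ 1 u := hu.of_le one_le_two
  have h2 : ContDiff ℝ 1 (pd p u) := contDiff_pd (m := 1) hu p
  have h3 : ContDiff ℝ 1 (xGrad u) := contDiff_xGrad (m := 1) hu
  have h4 : ContDiff ℝ 1 (gradSq u) := contDiff_gradSq (m := 1) hu
  unfold rellichField
  fun_prop

theorem pd_xGrad {n : ℕ} {u : (Fin n → ℝ) → ℝ} (hu : ContDiff ℝ 2 u) (p : Fin n)
    (x : Fin n → ℝ) : pd p (xGrad u) x = pd p u x + ∑ q, x q * pd p (pd q u) x := by
  have h2 (q : Fin n) : ContDiff ℝ 1 (pd q u) := contDiff_pd (m := 1) hu q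
  change pd p (fun y => ∑ q, y q * pd q u y) x = _
  rw [pd_sum fun q => (contDiff_apply ℝ ℝ q).mul (h2 q)]
  simp_rw [fun q => pd_mul (contDiff_apply ℝ ℝ q) (h2 q) p x, pd_coord, Finset.sum_add_distrib]
  simp

theorem pd_gradSq {n : ℕ} {u : (Fin n → ℝ) → ℝ} (hu : ContDiff ℝ 2 u) (p : Fin n)
    (x : Fin n → ℝ) : pd p (gradSq u) x = ∑ q, 2 * (pd q u x * pd p (pd q u) x) := by
  have h2 (q : Fin n) : ContDiff ℝ 1 (pd q u) := contDiff_pd (m := 1) hu q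
  change pd p (fun y => ∑ q, (pd q u y) ^ 2) x = _
  simp_rw [pow_two]
  rw [pd_sum fun q => (h2 q).mul (h2 q)]
  simp_rw [fun q => pd_mul (h2 q) (h2 q) p x]
  exact Finset.sum_congr rfl fun q _ => by ring

theorem pd_rellichField {n : ℕ} {u v : (Fin n → ℝ) → ℝ} (hu : ContDiff ℝ 2 u)
    (hv : ContDiff ℝ 1 v) (p : Fin n) (x : Fin n → ℝ) :
    pd p (rellichField u v p) x =
      v x ^ 2 + 2 * v x * (x p * pd p v x)
        + 2 * ((pd p u x) ^ 2 + (∑ q, x q * pd p (pd q u) x * pd p u x)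
          + xGrad u x * pd p (pd p u) x)
        - gradSq u x - (∑ q, 2 * (x p * pd q u x * pd p (pd q u) x))
        + ((n:ℝ) - 1) * ((pd p u x) ^ 2 + u x * pd p (pd p u) x) := by
  have h0 : ContDiff ℝ 1 (fun y : Fin n → ℝ => y p) := contDiff_apply ℝ ℝ p
  have h1 : ContDiff ℝ 1 u := hu.of_le one_le_two
  have h2 : ContDiff ℝ 1 (pd p u) := contDiff_pd (m := 1) hu p
  have h3 : ContDiff ℝ 1 (xGrad u) := contDiff_xGrad (m := 1) hu
  have h4 : ContDiff ℝ 1 (gradSq u) := contDiff_gradSq (m := 1) hu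
  have hc (c : ℝ) : ContDiff ℝ 1 (fun _ : Fin n → ℝ => c) := contDiff_const
  unfold rellichField
  rw [pd_add (by fun_prop) (by fun_prop), pd_sub (by fun_prop) (by fun_prop),
    pd_add (by fun_prop) (by fun_prop), pd_mul h0 (hv.mul hv), pd_mul hv hv,
    pd_mul (hc 2) (h3.mul h2), pd_mul h3 h2, pd_mul h0 h4, pd_mul (hc _) (h1.mul h2),
    pd_mul h1 h2, pd_const, pd_const, pd_coord, pd_xGrad hu, pd_gradSq hu,
    ← Finset.sum_mul]
  have : ∑ q, 2 * (x p * pd q u x * pd p (pd q u) x) =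
      x p * ∑ q, 2 * (pd q u x * pd p (pd q u) x) := by
    rw [Finset.mul_sum]
    exact Finset.sum_congr rfl fun q _ => by ring
  rw [this, if_pos rfl]
  ring

theorem sum_pd_rellichField {n : ℕ} {u v : (Fin n → ℝ) → ℝ} (hu : ContDiff ℝ 2 u)
    (hv : ContDiff ℝ 1 v) (x : Fin n → ℝ) :
    ∑ p, pd p (rellichField u v p) x =
      ((2 * xGrad v x + ((n:ℝ) - 1) * v x) * v x
        + (2 * xGrad u x + ((n:ℝ) - 1) * u x) * lap u x) + (v x ^ 2 + gradSq u x) := by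
  have hsymm : ∑ p, ∑ q, x q * pd p (pd q u) x * pd p u x =
      ∑ p, ∑ q, x p * pd q u x * pd p (pd q u) x := by
    rw [Finset.sum_comm]
    refine Finset.sum_congr rfl fun p _ => Finset.sum_congr rfl fun q _ => ?_
    rw [pd_comm hu]
    ring
  simp_rw [pd_rellichField hu hv, Finset.sum_add_distrib, Finset.sum_sub_distrib,
    Finset.sum_add_distrib, ← Finset.mul_sum, Finset.sum_add_distrib, ← Finset.mul_sum, hsymm]
  simp only [Finset.sum_const, Finset.card_univ, Fintype.card_fin, nsmul_eq_mul]
  simp only [lap, gradSq, xGrad]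
  ring

theorem pd_eq_zero_of_face {n : ℕ} {u : (Fin n → ℝ) → ℝ} (hu : Differentiable ℝ u)
    (hD : ∀ x ∈ cube n, (∃ p, x p = 0) → u x = 0) {x : Fin n → ℝ} (hx : x ∈ cube n)
    {p q : Fin n} (hp : x p = 0) (hpq : q ≠ p) : pd q u x = 0 := by
  have hmem : x q ∈ Set.Icc (0:ℝ) 1 := hx q (Set.mem_univ q)
  have h := hasDerivAt_comp_update (x := x) (p := q) (s := x q) (hu _)
  rw [Function.update_eq_self] at h
  have h0 : HasDerivWithinAt (fun r => u (Function.update x q r)) 0 (Set.Icc 0 1) (x q) :=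
    (hasDerivWithinAt_const (x q) (Set.Icc (0:ℝ) 1) (0:ℝ)).congr_of_mem
      (fun r hr => hD _ (update_mem_cube hx q hr) ⟨p, by simp [hpq.symm, hp]⟩) hmem
  exact (uniqueDiffOn_Icc zero_lt_one _ hmem).eq_deriv _ h.hasDerivWithinAt h0

theorem rellichField_eq_zero {n : ℕ} {u v : (Fin n → ℝ) → ℝ} (hu : Differentiable ℝ u)
    (hD : ∀ x ∈ cube n, (∃ p, x p = 0) → u x = 0) {x : Fin n → ℝ} (hx : x ∈ cube n)
    {p : Fin n} (hp : x p = 0) : rellichField u v p x = 0 := by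
  have h : xGrad u x = 0 := by
    refine Finset.sum_eq_zero fun q _ => ?_
    rcases eq_or_ne q p with rfl | hq
    · rw [hp, zero_mul]
    · rw [pd_eq_zero_of_face hu hD hx hp hq, mul_zero]
  simp [rellichField, h, hp, hD x hx ⟨p, hp⟩]

/-- The Rellich identity on the cube for a fixed time. -/
theorem integral_cube_rellich {n : ℕ} {k : ℝ} {u v : (Fin n → ℝ) → ℝ} (hu : ContDiff ℝ 2 u)
    (hv : ContDiff ℝ 1 v) (hD : ∀ x ∈ cube n, (∃ p, x p = 0) → u x = 0)
    (hN : ∀ x ∈ cube n, ∀ p, x p = 1 → pd p u x = -k * v x) :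
    ∫ x in cube n, ((2 * xGrad v x + ((n:ℝ) - 1) * v x) * v x
        + (2 * xGrad u x + ((n:ℝ) - 1) * u x) * lap u x) =
      -(∫ x in cube n, (v x ^ 2 + gradSq u x))
        - faceInt (fun x => gradSq u x + 2 * k * xGrad u x * v x)
        + faceInt (fun x => v x ^ 2 - k * ((n:ℝ) - 1) * u x * v x) := by
  have cu : Continuous u := hu.continuous
  have cv : Continuous v := hv.continuous
  have cG : Continuous (gradSq u) := (contDiff_gradSq (m := 1) hu).continuous
  have cX : Continuous (xGrad u) := (contDiff_xGrad (m := 1) hu).continuous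
  have hdiv : ∫ x in cube n, ∑ p, pd p (rellichField u v p) x =
      - faceInt (fun x => gradSq u x + 2 * k * xGrad u x * v x)
        + faceInt (fun x => v x ^ 2 - k * ((n:ℝ) - 1) * u x * v x) := by
    rw [integral_finsetSum _ fun p _ =>
      (continuous_pd (contDiff_rellichField hu hv p) p).integrableOn_cube]
    simp only [faceInt]
    rw [← Finset.sum_neg_distrib, ← Finset.sum_add_distrib]
    refine Finset.sum_congr rfl fun p _ => ?_
    rw [integral_cube_pd p (contDiff_rellichField hu hv p), ← integral_neg,
      ← integral_add (Continuous.integrableOn_cube (by fun_prop))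
        (Continuous.integrableOn_cube (by fun_prop))]
    refine setIntegral_congr_fun (measurableSet_cube n) fun x hx => ?_
    have m1 := update_mem_cube hx p (s := 1) (by simp)
    have m0 := update_mem_cube hx p (s := 0) (by simp)
    rw [rellichField_eq_zero (hu.differentiable two_ne_zero) hD m0 (p := p) (by simp),
      rellichField, hN _ m1 p (by simp), Function.update_self]
    ring
  have hint : IntegrableOn (fun x => ∑ p, pd p (rellichField u v p) x) (cube n) :=
    Continuous.integrableOn_cube <| continuous_finsetSum _ fun p _ =>
      continuous_pd (contDiff_rellichField hu hv p) p
  calc _ = ∫ x in cube n, (∑ p, pd p (rellichField u v p) x - (v x ^ 2 + gradSq u x)) := by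
        simp_rw [sum_pd_rellichField hu hv, add_sub_cancel_right]
    _ = _ := by
        rw [integral_sub hint (Continuous.integrableOn_cube (by fun_prop)), hdiv]
        ring

/-- Differentiation under the integral sign over the cube. -/
theorem hasDerivAt_integral_cube {n : ℕ} {F F' : ℝ → (Fin n → ℝ) → ℝ}
    (hF : ∀ s, Continuous (F s)) (hF' : Continuous fun q : ℝ × (Fin n → ℝ) => F' q.1 q.2)
    (hd : ∀ s x, HasDerivAt (fun r => F r x) (F' s x) s) (t : ℝ) :
    HasDerivAt (fun s => ∫ x in cube n, F s x) (∫ x in cube n, F' t x) t := by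
  obtain ⟨C, hC⟩ := (isCompact_Icc.prod (isCompact_cube n)).exists_bound_of_continuousOn
    (s := Set.Icc (t - 1) (t + 1) ×ˢ cube n) hF'.continuousOn
  refine (hasDerivAt_integral_of_dominated_loc_of_deriv_le (bound := fun _ => C)
    (Icc_mem_nhds (sub_one_lt t) (lt_add_one t))
    (Filter.Eventually.of_forall fun s => (hF s).aestronglyMeasurable)
    (hF t).integrableOn_cube
    (hF'.comp (Continuous.prodMk_right t)).aestronglyMeasurable
    ?_ (continuous_const.integrableOn_cube)
    (Filter.Eventually.of_forall fun x s _ => hd s x)).2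
  exact (ae_restrict_iff' (measurableSet_cube n)).2
    (Filter.Eventually.of_forall fun x hx s hs => hC (s, x) ⟨hs, hx⟩)

theorem hasDerivAt_slice {n : ℕ} {e : ℝ → (Fin n → ℝ) → ℝ}
    (he : ContDiff ℝ 1 fun q : ℝ × (Fin n → ℝ) => e q.1 q.2) (s : ℝ) (x : Fin n → ℝ) :
    HasDerivAt (fun τ => e τ x) (deriv (fun τ => e τ x) s) s := by
  have h : ContDiff ℝ 1 fun τ => e τ x := he.comp (contDiff_id.prodMk contDiff_const)
  exact (h.differentiable one_ne_zero s).hasDerivAt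

theorem contDiff_slice {n : ℕ} {e : ℝ → (Fin n → ℝ) → ℝ} {m : ℕ∞}
    (he : ContDiff ℝ m fun q : ℝ × (Fin n → ℝ) => e q.1 q.2) (s : ℝ) : ContDiff ℝ m (e s) :=
  he.comp (contDiff_const.prodMk contDiff_id)

theorem deriv_slice_eq {n : ℕ} {e : ℝ → (Fin n → ℝ) → ℝ}
    (he : Differentiable ℝ fun q : ℝ × (Fin n → ℝ) => e q.1 q.2) (s : ℝ) (x : Fin n → ℝ) :
    deriv (fun τ => e τ x) s = fderiv ℝ (fun q : ℝ × (Fin n → ℝ) => e q.1 q.2) (s, x) (1, 0) :=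
  ((he (s, x)).hasFDerivAt.comp_hasDerivAt (f := fun τ => (τ, x)) s
    ((hasDerivAt_id s).prodMk (hasDerivAt_const s x))).deriv

theorem pd_slice_eq {n : ℕ} {e : ℝ → (Fin n → ℝ) → ℝ}
    (he : Differentiable ℝ fun q : ℝ × (Fin n → ℝ) => e q.1 q.2) (p : Fin n) (s : ℝ)
    (x : Fin n → ℝ) : pd p (e s) x =
      fderiv ℝ (fun q : ℝ × (Fin n → ℝ) => e q.1 q.2) (s, x) (0, Pi.single p 1) := by
  have h : HasFDerivAt (e s) _ x := (he (s, x)).hasFDerivAt.comp x (hasFDerivAt_prodMk_right s x)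
  rw [pd, h.fderiv]
  rfl

theorem contDiff_timeDeriv {n : ℕ} {e : ℝ → (Fin n → ℝ) → ℝ} {m : ℕ}
    (he : ContDiff ℝ (m + 1) fun q : ℝ × (Fin n → ℝ) => e q.1 q.2) :
    ContDiff ℝ m fun q : ℝ × (Fin n → ℝ) => deriv (fun τ => e τ q.2) q.1 := by
  have hd := he.differentiable (by simp)
  simp_rw [deriv_slice_eq hd]
  exact (he.fderiv_right le_rfl).clm_apply contDiff_const

theorem contDiff_pd_slice {n : ℕ} {e : ℝ → (Fin n → ℝ) → ℝ} {m : ℕ}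
    (he : ContDiff ℝ (m + 1) fun q : ℝ × (Fin n → ℝ) => e q.1 q.2) (p : Fin n) :
    ContDiff ℝ m fun q : ℝ × (Fin n → ℝ) => pd p (e q.1) q.2 := by
  have hd := he.differentiable (by simp)
  simp_rw [pd_slice_eq hd]
  exact (he.fderiv_right le_rfl).clm_apply contDiff_const

theorem hasDerivAt_pd_slice {n : ℕ} {e : ℝ → (Fin n → ℝ) → ℝ}
    (he : ContDiff ℝ 2 fun q : ℝ × (Fin n → ℝ) => e q.1 q.2) (p : Fin n) (s : ℝ)
    (x : Fin n → ℝ) : HasDerivAt (fun τ => pd p (e τ) x)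
      (pd p (fun y => deriv (fun τ => e τ y) s) x) s := by
  have hd := he.differentiable two_ne_zero
  have hfd : DifferentiableAt ℝ (fderiv ℝ fun q : ℝ × (Fin n → ℝ) => e q.1 q.2) (s, x) :=
    (he.fderiv_right (m := 1) le_rfl).differentiable one_ne_zero _
  have h1 := hasDerivAt_slice (e := fun s x => pd p (e s) x) (contDiff_pd_slice (m := 1) he p) s x
  refine h1.congr_deriv ?_
  rw [deriv_slice_eq (e := fun s x => pd p (e s) x)
      ((contDiff_pd_slice (m := 1) he p).differentiable one_ne_zero),
    pd_slice_eq (e := fun s x => deriv (fun τ => e τ x) s)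
      ((contDiff_timeDeriv (m := 1) he).differentiable one_ne_zero)]
  simp_rw [pd_slice_eq hd, deriv_slice_eq hd]
  rw [fderiv_clm_apply hfd (differentiableAt_const _),
    fderiv_clm_apply hfd (differentiableAt_const _)]
  simpa using (he.contDiffAt.isSymmSndFDerivAt (by simp)) _ _

theorem hasDerivAt_xGrad_slice {n : ℕ} {e : ℝ → (Fin n → ℝ) → ℝ}
    (he : ContDiff ℝ 2 fun q : ℝ × (Fin n → ℝ) => e q.1 q.2) (s : ℝ) (x : Fin n → ℝ) :
    HasDerivAt (fun τ => xGrad (e τ) x) (xGrad (fun y => deriv (fun τ => e τ y) s) x) s :=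
  HasDerivAt.fun_sum fun p _ => (hasDerivAt_pd_slice he p s x).const_mul (x p)

/-- **Multiplier (Rellich-type) identity (identity (21) of the paper).** For a
classical (C²) solution of `e_tt = Δe + g(x,t)e` with `e = 0` on `Γ_D` and
`e_{x_p} = −k e_t` on each face `{x_p = 1}`,
`d/dt ∫_Ω [2(xᵀ∇e) + (n−1)e] e_t dx
  = −∫_Ω (e_t² + |∇e|²) dx + ∫_Ω [2(xᵀ∇e) + (n−1)e] g e dx
    − ∫_{Γ_N} (|∇e|² + 2k(xᵀ∇e)e_t) dΓ + ∫_{Γ_N} (e_t² − k(n−1)e e_t) dΓ`. -/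
theorem multiplier_identity (n : ℕ) (hn : 1 ≤ n) (k : ℝ) (hk : 0 < k)
    (t0 : ℝ) (e : ℝ → (Fin n → ℝ) → ℝ)
    (he : ContDiff ℝ 2 fun q : ℝ × (Fin n → ℝ) => e q.1 q.2)
    (g : (Fin n → ℝ) → ℝ → ℝ)
    (hg : Continuous fun q : (Fin n → ℝ) × ℝ => g q.1 q.2)
    (hwave : ∀ t, t0 < t → ∀ x ∈ cube n,
      deriv (deriv fun s => e s x) t = lap (e t) x + g x t * e t x)
    (hDir : ∀ t, t0 ≤ t → ∀ x ∈ cube n, (∃ p, x p = 0) → e t x = 0)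
    (hNeu : ∀ t, t0 ≤ t → ∀ x ∈ cube n, ∀ p, x p = 1 →
      pd p (e t) x = -k * deriv (fun s => e s x) t) :
    ∀ t, t0 < t →
      HasDerivAt
        (fun s => ∫ x in cube n,
          (2 * xGrad (e s) x + ((n:ℝ) - 1) * e s x) * deriv (fun τ => e τ x) s)
        (-(∫ x in cube n, ((deriv (fun τ => e τ x) t) ^ 2 + gradSq (e t) x))
          + (∫ x in cube n, (2 * xGrad (e t) x + ((n:ℝ) - 1) * e t x) * (g x t * e t x))
          - faceInt (fun x => gradSq (e t) x
              + 2 * k * xGrad (e t) x * deriv (fun τ => e τ x) t)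
          + faceInt (fun x => (deriv (fun τ => e τ x) t) ^ 2
              - k * ((n:ℝ) - 1) * e t x * deriv (fun τ => e τ x) t))
        t := by
  intro t ht
  have hslice (s : ℝ) : ContDiff ℝ 2 (e s) := contDiff_slice he s
  have cv : Continuous fun q : ℝ × (Fin n → ℝ) => deriv (fun τ => e τ q.2) q.1 :=
    (contDiff_timeDeriv (m := 1) he).continuous
  have cvt : Continuous fun q : ℝ × (Fin n → ℝ) => deriv (deriv fun τ => e τ q.2) q.1 :=
    (contDiff_timeDeriv (m := 0)
      (e := fun s x => deriv (fun τ => e τ x) s) (contDiff_timeDeriv (m := 1) he)).continuous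
  have cX : Continuous fun q : ℝ × (Fin n → ℝ) => xGrad (e q.1) q.2 :=
    continuous_finsetSum _ fun p _ => ((continuous_apply p).comp continuous_snd).mul
      (contDiff_pd_slice (m := 1) he p).continuous
  have cXv : Continuous fun q : ℝ × (Fin n → ℝ) =>
      xGrad (fun y => deriv (fun τ => e τ y) q.1) q.2 :=
    continuous_finsetSum _ fun p _ => ((continuous_apply p).comp continuous_snd).mul
      (contDiff_pd_slice (m := 0)
        (e := fun s x => deriv (fun τ => e τ x) s) (contDiff_timeDeriv (m := 1) he) p).continuous
  have ce : Continuous fun q : ℝ × (Fin n → ℝ) => e q.1 q.2 := he.continuous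
  have hv : ContDiff ℝ 1 fun x => deriv (fun τ => e τ x) t :=
    contDiff_slice (e := fun s x => deriv (fun τ => e τ x) s) (contDiff_timeDeriv (m := 1) he) t
  have hderiv := hasDerivAt_integral_cube
    (F := fun s x => (2 * xGrad (e s) x + ((n:ℝ) - 1) * e s x) * deriv (fun τ => e τ x) s)
    (F' := fun s x => (2 * xGrad (fun y => deriv (fun τ => e τ y) s) x
        + ((n:ℝ) - 1) * deriv (fun τ => e τ x) s) * deriv (fun τ => e τ x) s
      + (2 * xGrad (e s) x + ((n:ℝ) - 1) * e s x) * deriv (deriv fun τ => e τ x) s)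
    (fun s => (((cX.const_mul 2).add (ce.const_mul _)).mul cv).comp (Continuous.prodMk_right s))
    ((((cXv.const_mul 2).add (cv.const_mul _)).mul cv).add
      (((cX.const_mul 2).add (ce.const_mul _)).mul cvt))
    (fun s x => (((hasDerivAt_xGrad_slice he s x).const_mul 2).add
      ((hasDerivAt_slice (he.of_le one_le_two) s x).const_mul _)).mul
        (hasDerivAt_slice (e := fun s x => deriv (fun τ => e τ x) s)
          (contDiff_timeDeriv (m := 1) he) s x)) t
  refine hderiv.congr_deriv ?_
  have hrell := integral_cube_rellich (hslice t) hv (hDir t ht.le) (hNeu t ht.le)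
  have cu : Continuous (e t) := (hslice t).continuous
  have cXt : Continuous (xGrad (e t)) := (contDiff_xGrad (m := 1) (hslice t)).continuous
  have cXvt : Continuous (xGrad fun x => deriv (fun τ => e τ x) t) :=
    (contDiff_xGrad (m := 0) hv).continuous
  have cvt' : Continuous fun x => deriv (fun τ => e τ x) t := hv.continuous
  have clap : Continuous (lap (e t)) := continuous_finsetSum _ fun p _ =>
    continuous_pd (contDiff_pd (m := 1) (hslice t) p) p
  have cg : Continuous fun x => g x t := hg.comp (Continuous.prodMk_left t)
  calc _ = ∫ x in cube n, (((2 * xGrad (fun y => deriv (fun τ => e τ y) t) x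
            + ((n:ℝ) - 1) * deriv (fun τ => e τ x) t) * deriv (fun τ => e τ x) t
          + (2 * xGrad (e t) x + ((n:ℝ) - 1) * e t x) * lap (e t) x)
          + (2 * xGrad (e t) x + ((n:ℝ) - 1) * e t x) * (g x t * e t x)) := by
        refine setIntegral_congr_fun (measurableSet_cube n) fun x hx => ?_
        simp only [hwave t ht x hx]
        ring
    _ = _ := by
        rw [integral_add (Continuous.integrableOn_cube (by fun_prop))
          (Continuous.integrableOn_cube (by fun_prop)), hrell]
        ring
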